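/- Let f ∈ ℚ[x] be an irreducible polynomial of prime degree p with p > 7. If f has exactly 4 non-real complex roots, then the Galois group of f over ℚ is isomorphic to the alternating group A_p or to the symmetric group S_p. -/

import Mathlib

open Polynomial

open Equiv Finset in
/-- If the supports of two permutations meet in exactly one point, then their commutator is a
three-cycle. -/
lemma Equiv.Perm.isThreeCycle_commutator_of_card_support_inter_eq_one {α : Type*}
    [DecidableEq α] [Fintype α]
    {g h : Perm α} (hgh : #(g.support ∩ h.support) = 1) : (g * h * g⁻¹ * h⁻¹).IsThreeCycle := by
  obtain ⟨x, hx⟩ := Finset.card_eq_one.1 hgh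
  simp only [Finset.ext_iff, mem_inter, mem_support, mem_singleton] at hx
  rw [← card_support_eq_three_iff, card_eq_three]
  have ig := g.injective
  have ih := h.injective
  refine ⟨x, g x, h x, ?_, ?_, ?_, ?_⟩
  · grind
  · grind
  · have := hx (g x)
    grind [Function.Injective]
  · ext y
    simp only [mem_support, Perm.mul_apply, mem_insert, mem_singleton]
    have := hx y
    have := hx (h⁻¹ y)
    have := hx (g⁻¹ y)
    have := hx (g⁻¹ (h⁻¹ y))
    have := hx (h (g⁻¹ (h⁻¹ y)))
    have hg : ∀ y, g (g⁻¹ y) = y := by simp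
    have hh : ∀ y, h (h⁻¹ y) = y := by simp
    have hg' : ∀ y, g⁻¹ (g y) = y := by simp
    have hh' : ∀ y, h⁻¹ (h y) = y := by simp
    generalize g⁻¹ = g' at *
    generalize h⁻¹ = h' at *
    clear hgh
    grind (splits := 30)

set_option maxHeartbeats 2000000 in
/-- In a field of characteristic different from `2`, `3`, `5`, `7`, it is impossible that all
differences between two of four distinct elements are attained at least twice. -/
lemma false_of_differences_repeated {K : Type*} [Field K]
    (h2 : (2 : K) ≠ 0) (h3 : (3 : K) ≠ 0) (h5 : (5 : K) ≠ 0) (h7 : (7 : K) ≠ 0) {w x y z : K}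
    (hwx : w ≠ x) (hwz : w ≠ z) (hxy : x ≠ y) (hxz : x ≠ z) (hyz : y ≠ z)
    (h : ∀ a b c d : K, ({a, b, c, d} : Set K) = {w, x, y, z} →
      2 * a = b + c ∨ 2 * a = b + d ∨ 2 * b = a + c ∨ 2 * b = a + d ∨
        a + c = b + d ∨ a + d = b + c) : False := by
  have e1 := h w x y z rfl
  have e2 := h w y x z (by grind)
  have e3 := h w z x y (by grind)
  have e4 := h x y w z (by grind)
  have e5 := h x z w y (by grind)
  have e6 := h y z w x (by grind)
  clear h
  have h4 : (4 : K) ≠ 0 := by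
    have := mul_ne_zero h2 h2
    norm_num at this
    exact this
  grind (splits := 30) (ringSteps := 100000)

open Finset in
/-- A four-element subset of a field of characteristic different from `2`, `3`, `5`, `7` meets
one of its translates in exactly one point. -/
lemma exists_card_inter_image_add_eq_one {K : Type*} [Field K] [DecidableEq K]
    (h2 : (2 : K) ≠ 0) (h3 : (3 : K) ≠ 0) (h5 : (5 : K) ≠ 0) (h7 : (7 : K) ≠ 0)
    {B : Finset K} (hB : #B = 4) : ∃ d : K, #(B ∩ B.image (· + d)) = 1 := by
  by_contra! hcon
  obtain ⟨w, x, y, z, hwx, -, hwz, hxy, hxz, hyz, rfl⟩ := Finset.card_eq_four.1 hB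
  refine false_of_differences_repeated h2 h3 h5 h7 hwx hwz hxy hxz hyz fun a b c d hs ↦ ?_
  have hs' : ({w, x, y, z} : Finset K) = {a, b, c, d} := by
    rw [← Finset.coe_inj]
    push_cast
    exact hs.symm
  rw [hs'] at hB hcon
  have hab : a ≠ b := by
    rintro rfl
    have := Finset.card_le_three (a := a) (b := c) (c := d)
    simp_all
  have ha : a ∈ ({a, b, c, d} : Finset K) ∩ ({a, b, c, d} : Finset K).image (· + (a - b)) := by
    simp
  obtain ⟨v, hv, hva⟩ := (Finset.one_lt_card_iff_nontrivial.1
    (lt_of_le_of_ne (Finset.card_pos.2 ⟨a, ha⟩) (hcon (a - b)).symm)).exists_ne a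
  simp only [mem_inter, mem_image, mem_insert, mem_singleton] at hv
  obtain ⟨hv, u, hu, rfl⟩ := hv
  have hab2 : 2 * (a - b) ≠ 0 := mul_ne_zero h2 (sub_ne_zero.2 hab)
  clear hcon hB ha hs hs'
  rcases hv with hv | hv | hv | hv <;> rcases hu with rfl | rfl | rfl | rfl <;> grind

open Finset in
/-- Let `σ` be a permutation of prime order `p > 7` on `p` points. Every set of four points meets
one of its images under powers of `σ` in exactly one point. -/
lemma Equiv.Perm.exists_card_inter_map_pow_eq_one {α : Type*} [DecidableEq α] [Fintype α]
    (hp : (Fintype.card α).Prime) (hp7 : 7 < Fintype.card α) {σ : Equiv.Perm α}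
    (hσ : orderOf σ = Fintype.card α) {B : Finset α} (hB : #B = 4) :
    ∃ k : ℕ, #(B ∩ B.map (σ ^ k).toEmbedding) = 1 := by
  have hcyc := isCycle_of_prime_order'' hp hσ
  have hsupp : σ.support = univ := by
    rw [← card_eq_iff_eq_univ, ← hcyc.orderOf, hσ]
  have hmoved (x : α) : σ x ≠ x := by
    rw [← mem_support, hsupp]
    exact mem_univ x
  set p := Fintype.card α
  have : Fact p.Prime := ⟨hp⟩
  obtain ⟨x₀⟩ : Nonempty α := Fintype.card_pos_iff.1 hp.pos
  have hpow (n : ℕ) : σ ^ (n : ZMod p).val = σ ^ n := by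
    rw [ZMod.val_natCast, ← hσ, pow_mod_orderOf]
  let φ : ZMod p → α := fun i ↦ (σ ^ i.val) x₀
  have hφ : Function.Bijective φ := by
    rw [Fintype.bijective_iff_surjective_and_card]
    refine ⟨fun y ↦ ?_, ZMod.card p⟩
    obtain ⟨i, hi⟩ := hcyc.exists_pow_eq (hmoved x₀) (hmoved y)
    exact ⟨i, by rw [← hi, ← hpow i]⟩
  let e := Equiv.ofBijective φ hφ
  have he (i d : ZMod p) : e (i + d) = (σ ^ d.val) (e i) := by
    change (σ ^ (i + d).val) x₀ = (σ ^ d.val) ((σ ^ i.val) x₀)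
    rw [← mul_apply, ← pow_add, ← hpow (d.val + i.val)]
    simp [add_comm]
  have hne (n : ℕ) (hn : 0 < n) (hn7 : n ≤ 7) : (n : ZMod p) ≠ 0 := by
    rw [Ne, ZMod.natCast_eq_zero_iff]
    exact Nat.not_dvd_of_pos_of_lt hn (hn7.trans_lt hp7)
  obtain ⟨d, hd⟩ := exists_card_inter_image_add_eq_one (B := B.map e.symm.toEmbedding)
    (by simpa using hne 2) (by simpa using hne 3) (by simpa using hne 5) (by simpa using hne 7)
    (by simpa using hB)
  refine ⟨d.val, ?_⟩
  rw [← hd, ← card_map e.symm.toEmbedding, map_inter]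
  congr 2
  ext i
  simp only [mem_map_equiv, mem_image, Equiv.symm_symm]
  constructor
  · intro hi
    refine ⟨i - d, ?_, sub_add_cancel i d⟩
    rwa [← sub_add_cancel i d, he, Equiv.symm_apply_apply] at hi
  · rintro ⟨j, hj, rfl⟩
    rwa [he, Equiv.symm_apply_apply]

open Finset in
/-- A transitive permutation group of prime degree `p > 7` which contains a permutation moving
exactly four points contains the alternating group. -/
theorem Equiv.Perm.alternatingGroup_le_of_isPretransitive_of_card_support_eq_four
    {α : Type*} [DecidableEq α] [Fintype α] (hp : (Fintype.card α).Prime)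
    (hp7 : 7 < Fintype.card α) {G : Subgroup (Equiv.Perm α)} (hG : MulAction.IsPretransitive G α)
    {g : Equiv.Perm α} (hg : g ∈ G) (hg4 : #g.support = 4) : alternatingGroup α ≤ G := by
  have hprim : MulAction.IsPreprimitive G α :=
    MulAction.IsPreprimitive.of_prime_card (by rwa [Nat.card_eq_fintype_card])
  obtain ⟨x⟩ : Nonempty α := Fintype.card_pos_iff.1 hp.pos
  have hdvd : Fintype.card α ∣ Nat.card G := by
    rw [← Nat.card_eq_fintype_card, ← MulAction.index_stabilizer_of_transitive G x]
    exact Subgroup.index_dvd_card _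
  have : Fact (Fintype.card α).Prime := ⟨hp⟩
  obtain ⟨σ, hσ⟩ := exists_prime_orderOf_dvd_card' _ hdvd
  rw [← Subgroup.orderOf_coe] at hσ
  obtain ⟨k, hk⟩ := exists_card_inter_map_pow_eq_one hp hp7 hσ hg4
  rw [← support_conj] at hk
  have hσk : (σ : Equiv.Perm α) ^ k ∈ G := G.pow_mem σ.2 k
  have hh := G.mul_mem (G.mul_mem hσk hg) (G.inv_mem hσk)
  exact alternatingGroup_le_of_isPreprimitive_of_isThreeCycle_mem hprim
    (isThreeCycle_commutator_of_card_support_inter_eq_one hk)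
    (G.mul_mem (G.mul_mem (G.mul_mem hg hh) (G.inv_mem hg)) (G.inv_mem hh))

/-- A group of permutations containing the alternating group is the alternating group or the
full symmetric group. -/
lemma Equiv.Perm.eq_alternatingGroup_or_eq_top_of_alternatingGroup_le {α : Type*} [DecidableEq α]
    [Fintype α] [Nontrivial α] {G : Subgroup (Equiv.Perm α)} (hG : alternatingGroup α ≤ G) :
    G = alternatingGroup α ∨ G = ⊤ := by
  have hdvd := Subgroup.index_dvd_of_le hG
  rw [alternatingGroup.index_eq_two, Nat.dvd_prime Nat.prime_two] at hdvd
  exact hdvd.symm.imp eq_alternatingGroup_of_index_eq_two Subgroup.index_eq_one.1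

/-- The number of complex roots moved by complex conjugation is the number of non-real roots. -/
lemma Polynomial.Gal.card_support_galActionHom_conj {f : ℚ[X]}
    [Fact ((f.map (algebraMap ℚ ℂ)).Splits)] (hf : f ≠ 0) :
    (galActionHom f ℂ (restrict f ℂ
      (AlgEquiv.restrictScalars ℚ Complex.conjAe))).support.card =
      {z : ℂ | aeval z f = 0 ∧ z.im ≠ 0}.ncard := by
  rw [← Set.ncard_coe_finset, ← Set.ncard_image_of_injective _ Subtype.coe_injective]
  congr 1
  have hmoved (w : f.rootSet ℂ) :
      galActionHom f ℂ (restrict f ℂ (Complex.conjAe.restrictScalars ℚ)) w = w ↔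
        w.val.im = 0 := by
    rw [Subtype.ext_iff, galActionHom_restrict]
    exact Complex.conj_eq_iff_im
  ext z
  simp only [Set.mem_image, Finset.mem_coe, Equiv.Perm.mem_support, ne_eq, hmoved,
    Set.mem_ofPred_eq]
  constructor
  · rintro ⟨w, hw, rfl⟩
    exact ⟨(mem_rootSet.1 w.2).2, hw⟩
  · rintro ⟨hz, him⟩
    exact ⟨⟨z, mem_rootSet.2 ⟨hf, hz⟩⟩, him, rfl⟩

/-- If an irreducible polynomial over ℚ of prime degree p > 7 has exactly 4 non-real
complex roots, then its Galois group is A_p or S_p. -/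
theorem galois_group_eq_alternating_or_symmetric_of_4_nonreal_roots
    (f : ℚ[X]) (p : ℕ) (hp : p.Prime) (hpgt : 7 < p)
    (hdeg : f.natDegree = p) (hirr : Irreducible f)
    (hroots : {z : ℂ | aeval z f = 0 ∧ z.im ≠ 0}.ncard = 4) :
    Nonempty (f.Gal ≃* alternatingGroup (Fin p)) ∨
      Nonempty (f.Gal ≃* Equiv.Perm (Fin p)) := by
  classical
  have := Gal.splits_ℚ_ℂ (p := f)
  have hcard : Fintype.card (f.rootSet ℂ) = p := by
    rw [← hdeg]
    exact card_rootSet_eq_natDegree hirr.separable (IsAlgClosed.splits _)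
  have e : f.rootSet ℂ ≃ Fin p := Fintype.equivFinOfCardEq hcard
  have : Nontrivial (f.rootSet ℂ) := Fintype.one_lt_card_iff_nontrivial.1 (by lia)
  have hgal : f.Gal ≃* (Gal.galActionHom f ℂ).range :=
    MonoidHom.ofInjective (Gal.galActionHom_injective f ℂ)
  have htrans : MulAction.IsPretransitive (Gal.galActionHom f ℂ).range (f.rootSet ℂ) := by
    refine ⟨fun x y ↦ ?_⟩
    obtain ⟨s, hs⟩ := (Gal.galAction_isPretransitive f ℂ hirr).exists_smul_eq x y
    exact ⟨⟨Gal.galActionHom f ℂ s, s, rfl⟩, hs⟩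
  have hle := Equiv.Perm.alternatingGroup_le_of_isPretransitive_of_card_support_eq_four
    (hcard ▸ hp) (hcard ▸ hpgt) htrans ⟨_, rfl⟩
    ((Gal.card_support_galActionHom_conj hirr.ne_zero).trans hroots)
  obtain h | h := Equiv.Perm.eq_alternatingGroup_or_eq_top_of_alternatingGroup_le hle
  · exact .inl ⟨hgal.trans ((MulEquiv.subgroupCongr h).trans e.altCongrHom)⟩
  · exact .inr ⟨hgal.trans ((MulEquiv.subgroupCongr h).trans
      (Subgroup.topEquiv.trans e.permCongrHom))⟩
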